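/- Let Λ ⊆ (0,∞) be countable. Let X and Y be finite subsets of M_Λ, let P be a finite ultrametric space whose spectrum is contained in Λ, and let p₊ : X → P and p₋ : Y → P be isometric embeddings. Then there exists a surjective isometry g of M_Λ such that d(g(x), y) = d_P(p₊(x), p₋(y)) for all x ∈ X and y ∈ Y. -/

import Mathlib

/-- The model `M_Λ` of the ultrametric Urysohn space: functions `ω : Λ → ℤ` such that for
every `ε > 0` the set of `λ ∈ Λ` with `λ ≥ ε` and `ω(λ) ≠ 0` is finite. -/
abbrev UrysohnPt (Λ : Set ℝ) : Type :=
  {ω : Λ → ℤ // ∀ ε : ℝ, 0 < ε → {l : Λ | ε ≤ (l : ℝ) ∧ ω l ≠ 0}.Finite}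

/-- The distance on `M_Λ`: the largest `λ ∈ Λ` at which the two functions differ
(`sSup ∅ = 0` in Mathlib, so `uDist ω ω = 0`). -/
noncomputable def uDist {Λ : Set ℝ} (ω ω' : UrysohnPt Λ) : ℝ :=
  sSup ((fun l : Λ => (l : ℝ)) '' {l : Λ | ω.1 l ≠ ω'.1 l})

namespace UrysohnPt

variable {Λ : Set ℝ}

theorem finite_ne (ω ω' : UrysohnPt Λ) {ε : ℝ} (hε : 0 < ε) :
    {l : Λ | ε ≤ (l : ℝ) ∧ ω.1 l ≠ ω'.1 l}.Finite := by
  refine ((ω.2 ε hε).union (ω'.2 ε hε)).subset ?_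
  rintro l ⟨hl, hne⟩
  by_cases h : ω.1 l = 0
  · exact Or.inr ⟨hl, fun h' => hne (h.trans h'.symm)⟩
  · exact Or.inl ⟨hl, h⟩

theorem uDist_eq {ω ω' : UrysohnPt Λ} {l : Λ} (hl : ω.1 l ≠ ω'.1 l)
    (h : ∀ m : Λ, l < m → ω.1 m = ω'.1 m) : uDist ω ω' = l := by
  refine IsGreatest.csSup_eq ⟨⟨l, hl, rfl⟩, ?_⟩
  rintro _ ⟨m, hm, rfl⟩
  by_contra! hlt
  exact hm (h m hlt)

theorem uDist_self (ω : UrysohnPt Λ) : uDist ω ω = 0 := by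
  simp [uDist]

theorem uDist_comm (ω ω' : UrysohnPt Λ) : uDist ω ω' = uDist ω' ω := by
  simp only [uDist, ne_comm]

theorem exists_uDist_eq (hΛ : ∀ t ∈ Λ, 0 < t) {ω ω' : UrysohnPt Λ} (hne : ω ≠ ω') :
    ∃ l : Λ, ω.1 l ≠ ω'.1 l ∧ (∀ m : Λ, l < m → ω.1 m = ω'.1 m) ∧ uDist ω ω' = l := by
  obtain ⟨k, hk⟩ : ∃ k, ω.1 k ≠ ω'.1 k := by
    by_contra! h
    exact hne (Subtype.ext (funext h))
  obtain ⟨l, ⟨hkl, hl⟩, hmax⟩ := Set.exists_max_image _ (fun l : Λ => (l : ℝ))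
    (finite_ne ω ω' (hΛ k k.2)) ⟨k, le_rfl, hk⟩
  have habove : ∀ m : Λ, l < m → ω.1 m = ω'.1 m := by
    intro m hm
    by_contra h
    exact (hmax m ⟨hkl.trans hm.le, h⟩).not_gt hm
  exact ⟨l, hl, habove, uDist_eq hl habove⟩

theorem uDist_nonneg (hΛ : ∀ t ∈ Λ, 0 < t) (ω ω' : UrysohnPt Λ) : 0 ≤ uDist ω ω' := by
  rcases eq_or_ne ω ω' with rfl | hne
  · exact (uDist_self ω).ge
  · obtain ⟨l, -, -, hl⟩ := exists_uDist_eq hΛ hne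
    exact hl ▸ (hΛ l l.2).le

theorem uDist_pos (hΛ : ∀ t ∈ Λ, 0 < t) {ω ω' : UrysohnPt Λ} (hne : ω ≠ ω') :
    0 < uDist ω ω' := by
  obtain ⟨l, -, -, hl⟩ := exists_uDist_eq hΛ hne
  exact hl ▸ hΛ l l.2

theorem uDist_le_iff (hΛ : ∀ t ∈ Λ, 0 < t) {ω ω' : UrysohnPt Λ} {r : ℝ} (hr : 0 ≤ r) :
    uDist ω ω' ≤ r ↔ ∀ l : Λ, r < l → ω.1 l = ω'.1 l := by
  rcases eq_or_ne ω ω' with rfl | hne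
  · simpa [uDist_self] using hr
  · obtain ⟨k, hk, habove, hd⟩ := exists_uDist_eq hΛ hne
    rw [hd]
    constructor
    · exact fun h l hl => habove l (h.trans_lt hl)
    · intro h
      by_contra! hlt
      exact hk (h k hlt)

theorem uDist_le_max (hΛ : ∀ t ∈ Λ, 0 < t) (x y z : UrysohnPt Λ) :
    uDist x z ≤ max (uDist x y) (uDist y z) := by
  rw [uDist_le_iff hΛ (le_max_of_le_left (uDist_nonneg hΛ x y))]
  intro l hl
  rw [max_lt_iff] at hl
  exact ((uDist_le_iff hΛ (uDist_nonneg hΛ x y)).1 le_rfl l hl.1).trans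
    ((uDist_le_iff hΛ (uDist_nonneg hΛ y z)).1 le_rfl l hl.2)

theorem uDist_eq_of_lt (hΛ : ∀ t ∈ Λ, 0 < t) {x y z : UrysohnPt Λ}
    (h : uDist x y < uDist y z) : uDist x z = uDist y z := by
  have h₁ := uDist_le_max hΛ x y z
  have h₂ := uDist_le_max hΛ y x z
  rw [uDist_comm y x] at h₂
  grind

/-- Translation by `v - u`. -/
def translate (u v w : UrysohnPt Λ) : UrysohnPt Λ :=
  ⟨fun l => w.1 l + v.1 l - u.1 l, fun ε hε => by
    refine (((w.2 ε hε).union (v.2 ε hε)).union (u.2 ε hε)).subset ?_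
    rintro l ⟨hl, hne⟩
    by_contra h
    simp only [Set.mem_union, Set.mem_ofPred_eq, hl, true_and, not_or, not_not] at h
    exact hne (by simp [h])⟩

theorem translate_translate (u v w : UrysohnPt Λ) : translate v u (translate u v w) = w :=
  Subtype.ext (funext fun l => by simp [translate])

theorem translate_left (u v : UrysohnPt Λ) : translate u v u = v :=
  Subtype.ext (funext fun l => by simp [translate])

theorem uDist_translate (u v w w' : UrysohnPt Λ) :
    uDist (translate u v w) (translate u v w') = uDist w w' := by
  simp [uDist, translate]

theorem uDist_translate_left (u v w : UrysohnPt Λ) : uDist (translate u v w) v = uDist w u := by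
  simpa only [translate_left] using uDist_translate u v w u

open Classical in
/-- The exchange of the open balls of radius `uDist u v` around `u` and `v` by translations. -/
noncomputable def ballSwap (u v w : UrysohnPt Λ) : UrysohnPt Λ :=
  if uDist w u < uDist u v then translate u v w
  else if uDist w v < uDist u v then translate v u w else w

theorem ballSwap_involutive (hΛ : ∀ t ∈ Λ, 0 < t) (u v : UrysohnPt Λ) :
    Function.Involutive (ballSwap u v) := by
  intro w
  by_cases h₁ : uDist w u < uDist u v
  · have h : uDist (translate u v w) v < uDist u v := by rwa [uDist_translate_left]
    have h' : ¬ uDist (translate u v w) u < uDist u v := fun hu =>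
      h.ne (uDist_eq_of_lt hΛ hu)
    simp [ballSwap, h₁, h, h', translate_translate]
  · by_cases h₂ : uDist w v < uDist u v
    · have h : uDist (translate v u w) u < uDist u v := by rwa [uDist_translate_left]
      simp [ballSwap, h₁, h₂, h, translate_translate]
    · simp [ballSwap, h₁, h₂]

theorem ballSwap_comm (hΛ : ∀ t ∈ Λ, 0 < t) (u v : UrysohnPt Λ) :
    ballSwap u v = ballSwap v u := by
  funext w
  have h : uDist w u < uDist u v → ¬ uDist w v < uDist u v := fun hu hv =>
    hv.ne (uDist_eq_of_lt hΛ hu)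
  simp only [ballSwap, uDist_comm v u]
  grind

theorem uDist_translate_of_not_mem (hΛ : ∀ t ∈ Λ, 0 < t) {u v w w' : UrysohnPt Λ}
    (hw : uDist w u < uDist u v) (hu : ¬ uDist w' u < uDist u v)
    (hv : ¬ uDist w' v < uDist u v) : uDist (translate u v w) w' = uDist w w' := by
  rw [not_lt, uDist_comm w'] at hu hv
  have h₁ := uDist_eq_of_lt hΛ (hw.trans_le hu)
  have h₂ := uDist_eq_of_lt hΛ (((uDist_translate_left u v w).trans_lt hw).trans_le hv)
  rw [h₁, h₂]
  have h₃ := uDist_le_max hΛ u v w'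
  have h₄ := uDist_le_max hΛ v u w'
  rw [uDist_comm v u] at h₄
  grind

theorem uDist_of_mem_balls (hΛ : ∀ t ∈ Λ, 0 < t) {u v w w' : UrysohnPt Λ}
    (hw : uDist w u < uDist u v) (hw' : uDist w' v < uDist u v) : uDist w w' = uDist u v := by
  have h₁ := uDist_eq_of_lt hΛ hw
  rw [uDist_comm u v, uDist_comm w v] at h₁
  rw [uDist_comm w w', uDist_eq_of_lt hΛ (hw'.trans_eq ((uDist_comm u v).trans h₁.symm)), h₁,
    uDist_comm]

theorem uDist_ballSwap (hΛ : ∀ t ∈ Λ, 0 < t) (u v w w' : UrysohnPt Λ) :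
    uDist (ballSwap u v w) (ballSwap u v w') = uDist w w' := by
  have key : ∀ {u v w : UrysohnPt Λ} (w'), uDist w u < uDist u v →
      uDist (ballSwap u v w) (ballSwap u v w') = uDist w w' := by
    intro u v w w' h
    by_cases h₁ : uDist w' u < uDist u v
    · simp [ballSwap, h, h₁, uDist_translate]
    · by_cases h₂ : uDist w' v < uDist u v
      · simp only [ballSwap, h, h₁, h₂, if_true, if_false]
        rw [uDist_of_mem_balls hΛ h h₂, uDist_comm]
        exact uDist_of_mem_balls hΛ (by rwa [uDist_translate_left])
          (by rwa [uDist_translate_left])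
      · simp only [ballSwap, h, h₁, h₂, if_true, if_false]
        exact uDist_translate_of_not_mem hΛ h h₁ h₂
  have key' : ∀ w w', uDist w u < uDist u v ∨ uDist w v < uDist u v →
      uDist (ballSwap u v w) (ballSwap u v w') = uDist w w' := by
    rintro w w' (h | h)
    · exact key w' h
    · rw [ballSwap_comm hΛ]
      exact key w' (by rwa [uDist_comm v u])
  by_cases hw : uDist w u < uDist u v ∨ uDist w v < uDist u v
  · exact key' w w' hw
  by_cases hw' : uDist w' u < uDist u v ∨ uDist w' v < uDist u v
  · rw [uDist_comm, uDist_comm w]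
    exact key' w' w hw'
  rw [not_or] at hw hw'
  simp [ballSwap, hw, hw']

theorem ballSwap_left (hΛ : ∀ t ∈ Λ, 0 < t) (u v : UrysohnPt Λ) : ballSwap u v u = v := by
  rcases eq_or_ne u v with rfl | h
  · simp [ballSwap, uDist_self]
  · simp [ballSwap, uDist_self, uDist_pos hΛ h, translate_left]

theorem ballSwap_of_uDist_eq (hΛ : ∀ t ∈ Λ, 0 < t) {u v a : UrysohnPt Λ}
    (h : uDist a u = uDist a v) : ballSwap u v a = a := by
  have h' : ¬ uDist a u < uDist u v := fun hu =>
    (h ▸ hu).ne (uDist_eq_of_lt hΛ hu)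
  simp [ballSwap, h', ← h]

/-- Finite partial isometries of `M_Λ` extend to isometries of `M_Λ`. -/
theorem exists_isometry_extending (hΛ : ∀ t ∈ Λ, 0 < t) {ι : Type*} (a b : ι → UrysohnPt Λ)
    (hab : ∀ i j, uDist (a i) (a j) = uDist (b i) (b j)) (T : Finset ι) :
    ∃ g : UrysohnPt Λ → UrysohnPt Λ, Function.Bijective g ∧
      (∀ ω ω', uDist (g ω) (g ω') = uDist ω ω') ∧ ∀ i ∈ T, g (a i) = b i := by
  classical
  induction T using Finset.induction_on with
  | empty => exact ⟨id, Function.bijective_id, fun _ _ => rfl, by simp⟩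
  | insert i T _ ih =>
    obtain ⟨g, hg, hiso, hgT⟩ := ih
    refine ⟨ballSwap (g (a i)) (b i) ∘ g, (ballSwap_involutive hΛ _ _).bijective.comp hg,
      fun ω ω' => (uDist_ballSwap hΛ _ _ _ _).trans (hiso ω ω'), fun j hj => ?_⟩
    rcases Finset.mem_insert.1 hj with rfl | hj
    · exact ballSwap_left hΛ _ _
    · rw [Function.comp_apply, hgT j hj]
      apply ballSwap_of_uDist_eq hΛ
      rw [← hab, ← hgT j hj, hiso]

/-- The point obtained from `ω` by changing the coordinate `l` to `n`. -/
noncomputable def setCoord (ω : UrysohnPt Λ) (l : Λ) (n : ℤ) : UrysohnPt Λ :=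
  ⟨fun m => open Classical in if m = l then n else ω.1 m, fun ε hε => by
    refine ((ω.2 ε hε).insert l).subset ?_
    rintro m ⟨hm, hne⟩
    by_cases h : m = l
    · exact Or.inl h
    · exact Or.inr ⟨hm, by simpa [h] using hne⟩⟩

/-- The one-point extension property of `M_Λ`. -/
theorem exists_uDist_eq_dist (hΛ : ∀ t ∈ Λ, 0 < t) {P : Type*} [MetricSpace P]
    (hPu : ∀ x y z : P, dist x z ≤ max (dist x y) (dist y z))
    (hPspec : ∀ x y : P, x ≠ y → dist x y ∈ Λ)
    {S : Set P} (hS : S.Finite) {q : P → UrysohnPt Λ}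
    (hq : ∀ s ∈ S, ∀ t ∈ S, uDist (q s) (q t) = dist s t) {p : P} (hp : p ∉ S) :
    ∃ z : UrysohnPt Λ, ∀ s ∈ S, uDist z (q s) = dist p s := by
  rcases S.eq_empty_or_nonempty with rfl | hne
  · exact ⟨q p, by simp⟩
  obtain ⟨s₀, hs₀, hmin⟩ := Set.exists_min_image S (dist p) hS hne
  let l : Λ := ⟨dist p s₀, hPspec p s₀ fun h => hp (h ▸ hs₀)⟩
  obtain ⟨n, hn⟩ := (hS.image fun s => (q s).1 l).exists_notMem
  have hn' : ∀ s ∈ S, n ≠ (q s).1 l := fun s hs h => hn ⟨s, hs, h.symm⟩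
  have hz : ∀ m : Λ, l < m → (setCoord (q s₀) l n).1 m = (q s₀).1 m := fun m hm => by
    simp [setCoord, hm.ne']
  have hz₀ : uDist (setCoord (q s₀) l n) (q s₀) = dist p s₀ :=
    uDist_eq (l := l) (by simpa [setCoord] using hn' s₀ hs₀) hz
  refine ⟨setCoord (q s₀) l n, fun s hs => ?_⟩
  have h₁ := hPu p s₀ s
  have h₂ := hPu s₀ p s
  rw [dist_comm s₀ p] at h₂
  have h₃ := hmin s hs
  rcases lt_or_ge (dist p s₀) (dist s₀ s) with hlt | hle
  · rw [uDist_eq_of_lt hΛ (y := q s₀) (by rwa [hz₀, hq _ hs₀ _ hs]), hq _ hs₀ _ hs]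
    grind
  · have hps : dist p s = l := le_antisymm (by grind) h₃
    rw [hps]
    refine uDist_eq (by simpa [setCoord] using hn' s hs) fun m hm => (hz m hm).trans ?_
    exact (uDist_le_iff hΛ (hΛ l l.2).le).1 ((hq _ hs₀ _ hs).trans_le hle) m hm

/-- Isometric maps into `M_Λ` from subspaces of finite ultrametric spaces with spectrum in `Λ`
extend to the whole space. -/
theorem exists_isometric_extension (hΛ : ∀ t ∈ Λ, 0 < t) {P : Type*} [MetricSpace P] [Finite P]
    (hPu : ∀ x y z : P, dist x z ≤ max (dist x y) (dist y z))
    (hPspec : ∀ x y : P, x ≠ y → dist x y ∈ Λ) (S : Set P) (q₀ : P → UrysohnPt Λ)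
    (hq₀ : ∀ s ∈ S, ∀ t ∈ S, uDist (q₀ s) (q₀ t) = dist s t) :
    ∃ q : P → UrysohnPt Λ, (∀ s t, uDist (q s) (q t) = dist s t) ∧ ∀ s ∈ S, q s = q₀ s := by
  classical
  have key : ∀ T : Set P, T.Finite → ∃ q : P → UrysohnPt Λ,
      (∀ s ∈ S ∪ T, ∀ t ∈ S ∪ T, uDist (q s) (q t) = dist s t) ∧ ∀ s ∈ S, q s = q₀ s := by
    intro T hT
    induction T, hT using Set.Finite.induction_on with
    | empty => exact ⟨q₀, by simpa using hq₀, fun _ _ => rfl⟩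
    | @insert p T _ _ ih =>
      obtain ⟨q, hq, hqS⟩ := ih
      by_cases hp : p ∈ S ∪ T
      · exact ⟨q, by rwa [Set.union_insert, Set.insert_eq_of_mem hp], hqS⟩
      obtain ⟨z, hz⟩ := exists_uDist_eq_dist hΛ hPu hPspec (S ∪ T).toFinite hq hp
      have hne : ∀ s ∈ S ∪ T, s ≠ p := fun s hs h => hp (h ▸ hs)
      refine ⟨Function.update q p z, ?_, fun s hs => ?_⟩
      · rw [Set.union_insert]
        rintro s (rfl | hs) t (rfl | ht)
        · simp [uDist_self]
        · simpa [hne t ht] using hz t ht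
        · simpa [hne s hs, uDist_comm _ z, dist_comm s] using hz s hs
        · simpa [hne s hs, hne t ht] using hq s hs t ht
      · rw [Function.update_of_ne (hne s (Or.inl hs)), hqS s hs]
  obtain ⟨q, hq, hqS⟩ := key Set.univ Set.finite_univ
  exact ⟨q, fun s t => hq s (by simp) t (by simp), hqS⟩

end UrysohnPt

/-- Realization of morphisms of the amalgamation category by isometries of `M_Λ`
(identification of double cosets): given finite subsets `X, Y ⊆ M_Λ`, a finite ultrametric
space `P` with spectrum in `Λ`, and isometric embeddings `pPlus : X → P`, `pMinus : Y → P`, there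
is a surjective isometry `g` of `M_Λ` with `d(g x, y) = d_P(pPlus x, pMinus y)` for all
`x ∈ X`, `y ∈ Y`. -/
theorem urysohnSpace_morphism_realized_by_isometry
    (Λ : Set ℝ) (hΛc : Λ.Countable) (hΛ : ∀ t ∈ Λ, 0 < t)
    (X Y : Set (UrysohnPt Λ)) (hX : X.Finite) (hY : Y.Finite)
    (P : Type*) [MetricSpace P] [Finite P]
    (hPu : ∀ x y z : P, dist x z ≤ max (dist x y) (dist y z))
    (hPspec : ∀ x y : P, x ≠ y → dist x y ∈ Λ)
    (pPlus : X → P)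
    (hpPlus : ∀ a b : X, dist (pPlus a) (pPlus b) = uDist (a : UrysohnPt Λ) (b : UrysohnPt Λ))
    (pMinus : Y → P)
    (hpMinus : ∀ a b : Y, dist (pMinus a) (pMinus b) = uDist (a : UrysohnPt Λ) (b : UrysohnPt Λ)) :
    ∃ g : UrysohnPt Λ → UrysohnPt Λ, Function.Bijective g ∧
      (∀ ω ω' : UrysohnPt Λ, uDist (g ω) (g ω') = uDist ω ω') ∧
      ∀ (x : X) (y : Y), uDist (g (x : UrysohnPt Λ)) (y : UrysohnPt Λ)
        = dist (pPlus x) (pMinus y) := by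
  classical
  have hinj : Function.Injective pMinus := by
    intro a b hab
    by_contra hne
    have h := UrysohnPt.uDist_pos hΛ fun h => hne (Subtype.ext h)
    rw [← hpMinus a b, hab, dist_self] at h
    exact h.false
  obtain ⟨q, hq, hqY⟩ := UrysohnPt.exists_isometric_extension hΛ hPu hPspec (Set.range pMinus)
    (Function.extend pMinus (fun y => (y : UrysohnPt Λ)) fun _ => ⟨0, by simp⟩) (by
      rintro _ ⟨a, rfl⟩ _ ⟨b, rfl⟩
      rw [hinj.extend_apply, hinj.extend_apply, hpMinus])
  have := hX.fintype
  obtain ⟨g, hg, hiso, hgX⟩ := UrysohnPt.exists_isometry_extending hΛ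
    (fun x : X => (x : UrysohnPt Λ)) (fun x => q (pPlus x))
    (fun a b => by rw [hq, hpPlus]) Finset.univ
  refine ⟨g, hg, hiso, fun x y => ?_⟩
  rw [hgX x (Finset.mem_univ x), ← hq, hqY _ ⟨y, rfl⟩, hinj.extend_apply]
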